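/- (Five-term spinor Plücker relation on subPfaffians.) Let Ξ be a skew-symmetric matrix over a commutative ring whose index set contains {1,2,3,4,5}. Then Pf(Ξ_{{1,2}})·Pf(Ξ_{{1,3,4,5}}) − Pf(Ξ_{{1,3}})·Pf(Ξ_{{1,2,4,5}}) + Pf(Ξ_{{1,4}})·Pf(Ξ_{{1,2,3,5}}) − Pf(Ξ_{{1,5}})·Pf(Ξ_{{1,2,3,4}}) = 0; that is, the homogeneous spinor relation ξ₁₂ξ₁₃₄₅ − ξ₁₃ξ₁₂₄₅ + ξ₁₄ξ₁₂₃₅ − ξ₁₅ξ₁₂₃₄ vanishes identically on subPfaffian tensors of skew-symmetric matrices. -/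

import Mathlib

/-- The subPfaffian of a skew-symmetric matrix, defined by recursive expansion
along the row of the minimal index of `I`; `pf M I` is the Pfaffian of the principal
submatrix of `M` on the index set `I`.  It is `1` for `I = ∅` and `0` for `|I|` odd. -/
def pf {R : Type*} [CommRing R] (M : ℕ → ℕ → R) (I : Finset ℕ) : R :=
  if h : I.Nonempty then
    ∑ j ∈ I.erase (I.min' h),
      (-1 : R) ^ ((I.filter (fun t => t < j)).card + 1) * M (I.min' h) j *
        pf M ((I.erase (I.min' h)).erase j)
  else 1
termination_by I.card
decreasing_by
  exact lt_of_le_of_lt (Finset.card_le_card (Finset.erase_subset _ _))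
    (Finset.card_erase_lt_of_mem (I.min'_mem h))

theorem pf_empty_aux {R : Type*} [CommRing R] (M : ℕ → ℕ → R) : pf M ∅ = 1 := by
  rw [pf]; simp

/-- Expansion along the minimal index. -/
theorem pf_insert_aux {R : Type*} [CommRing R] (M : ℕ → ℕ → R) (m : ℕ) (J : Finset ℕ)
    (hm : ∀ j ∈ J, m < j) :
    pf M (insert m J) =
      ∑ j ∈ J, (-1 : R) ^ (J.filter (fun t => t < j)).card * M m j * pf M (J.erase j) := by
  have hmJ : m ∉ J := fun h => lt_irrefl _ (hm m h)
  have hne : (insert m J).Nonempty := Finset.insert_nonempty _ _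
  have hmin : (insert m J).min' hne = m := by
    apply le_antisymm
    · exact Finset.min'_le _ _ (Finset.mem_insert_self _ _)
    · apply Finset.le_min'
      intro y hy
      rcases Finset.mem_insert.1 hy with rfl | hy
      · exact le_rfl
      · exact (hm y hy).le
  rw [pf, dif_pos hne]
  simp only [hmin, Finset.erase_insert hmJ]
  refine Finset.sum_congr rfl fun j hj => ?_
  rw [Finset.filter_insert, if_pos (hm j hj), Finset.card_insert_of_notMem (by simp [hmJ])]
  congr 2
  ring

theorem pf_pair_aux {R : Type*} [CommRing R] (M : ℕ → ℕ → R) (a b : ℕ) (h : a < b) :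
    pf M {a, b} = M a b := by
  rw [pf_insert_aux M a {b} (by simpa using h)]
  simp [pf_empty_aux, Finset.filter_singleton]

theorem pf_four_aux {R : Type*} [CommRing R] (M : ℕ → ℕ → R) (a b c d : ℕ)
    (h : a < b) (h1 : b < c) (h2 : c < d) :
    pf M {a, b, c, d} = M a b * M c d - M a c * M b d + M a d * M b c := by
  rw [pf_insert_aux M a {b, c, d} (by simp; omega)]
  rw [Finset.sum_insert (by simp; omega), Finset.sum_insert (by simp; omega),
    Finset.sum_singleton]
  have e1 : ({b, c, d} : Finset ℕ).erase b = {c, d} := by ext x; simp; omega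
  have e2 : ({b, c, d} : Finset ℕ).erase c = {b, d} := by ext x; simp; omega
  have e3 : ({b, c, d} : Finset ℕ).erase d = {b, c} := by ext x; simp; omega
  have f1 : ({b, c, d} : Finset ℕ).filter (fun t => t < b) = ∅ := by ext x; simp; omega
  have f2 : ({b, c, d} : Finset ℕ).filter (fun t => t < c) = {b} := by ext x; simp; omega
  have f3 : ({b, c, d} : Finset ℕ).filter (fun t => t < d) = {b, c} := by ext x; simp; omega
  rw [e1, e2, e3, f1, f2, f3, pf_pair_aux M c d h2, pf_pair_aux M b d (by omega),
    pf_pair_aux M b c h1, Finset.card_pair h1.ne]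
  simp
  ring

/-- The five-term spinor Plücker relation
`ξ₁₂ξ₁₃₄₅ − ξ₁₃ξ₁₂₄₅ + ξ₁₄ξ₁₂₃₅ − ξ₁₅ξ₁₂₃₄ = 0` holds identically on subPfaffian
tensors of skew-symmetric matrices, where `ξ_I = Pf(Ξ_I)`. -/
theorem spinor_plucker_relation {R : Type*} [CommRing R] (Ξ : ℕ → ℕ → R)
    (hskew : ∀ i j, Ξ j i = - Ξ i j) :
    pf Ξ ({1, 2} : Finset ℕ) * pf Ξ ({1, 3, 4, 5} : Finset ℕ)
      - pf Ξ ({1, 3} : Finset ℕ) * pf Ξ ({1, 2, 4, 5} : Finset ℕ)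
      + pf Ξ ({1, 4} : Finset ℕ) * pf Ξ ({1, 2, 3, 5} : Finset ℕ)
      - pf Ξ ({1, 5} : Finset ℕ) * pf Ξ ({1, 2, 3, 4} : Finset ℕ) = 0 := by
  rw [pf_pair_aux Ξ 1 2 (by omega), pf_pair_aux Ξ 1 3 (by omega), pf_pair_aux Ξ 1 4 (by omega),
    pf_pair_aux Ξ 1 5 (by omega), pf_four_aux Ξ 1 3 4 5 (by omega) (by omega) (by omega),
    pf_four_aux Ξ 1 2 4 5 (by omega) (by omega) (by omega),
    pf_four_aux Ξ 1 2 3 5 (by omega) (by omega) (by omega),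
    pf_four_aux Ξ 1 2 3 4 (by omega) (by omega) (by omega)]
  ring
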